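/- Let X be a complex Hilbert space and let A be the generator of a bounded C₀-semigroup (T(t))_{t≥0} on X. Suppose that σ(A) ∩ iℝ = {0}, that sup_{|s|≥1} ‖R(is,A)‖ < ∞, and that M : [1,∞) → (0,∞) is a continuous non-decreasing function of positive increase such that sup_{s⁻¹ ≤ |r| ≤ 1} ‖R(ir,A)‖ ≤ M(s) for all s ≥ 1. Then ‖T(t)AR(1,A)‖ = O(1/M⁻¹(t)) as t → ∞. -/

import Mathlib

open Filter Topology MeasureTheory

noncomputable section

/-- `T` is a (one-parameter) `C₀`-semigroup on `X`, indexed by `t ≥ 0`. -/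
structure IsC0Semigroup {X : Type*} [NormedAddCommGroup X] [NormedSpace ℂ X]
    (T : ℝ → X →L[ℂ] X) : Prop where
  map_zero : T 0 = 1
  map_add : ∀ s t : ℝ, 0 ≤ s → 0 ≤ t → T (s + t) = T s ∘L T t
  strong_continuity : ∀ x : X, ContinuousOn (fun t => T t x) (Set.Ici (0 : ℝ))

/-- `A` (a closed, densely defined, partially defined linear operator) is the
infinitesimal generator of the semigroup `T`. -/
structure IsGenerator {X : Type*} [NormedAddCommGroup X] [NormedSpace ℂ X]
    (T : ℝ → X →L[ℂ] X) (A : X →ₗ.[ℂ] X) : Prop where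
  dense_domain : Dense (A.domain : Set X)
  mem_domain_iff : ∀ x : X, x ∈ A.domain ↔
    ∃ y : X, Tendsto (fun t : ℝ => t⁻¹ • (T t x - x)) (𝓝[>] (0 : ℝ)) (𝓝 y)
  tendsto_generator : ∀ x : A.domain,
    Tendsto (fun t : ℝ => t⁻¹ • (T t (x : X) - (x : X))) (𝓝[>] (0 : ℝ)) (𝓝 (A x))

/-- `R` is the resolvent operator `R(z, A) = (z I - A)⁻¹` of `A` at the point `z`;
in particular `z` belongs to the resolvent set of `A`. -/
structure IsResolvent {X : Type*} [NormedAddCommGroup X] [NormedSpace ℂ X]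
    (A : X →ₗ.[ℂ] X) (z : ℂ) (R : X →L[ℂ] X) : Prop where
  mem_domain : ∀ x : X, R x ∈ A.domain
  right_inv : ∀ x : X, z • R x - A ⟨R x, mem_domain x⟩ = x
  left_inv : ∀ x : A.domain, R (z • (x : X) - A x) = (x : X)

/-- The spectrum `σ(A)` of the partially defined operator `A`: the set of `z ∈ ℂ`
at which no (bounded, everywhere defined) resolvent operator for `A` exists. -/
def pmSpectrum {X : Type*} [NormedAddCommGroup X] [NormedSpace ℂ X]
    (A : X →ₗ.[ℂ] X) : Set ℂ :=
  {z : ℂ | ¬∃ R : X →L[ℂ] X, IsResolvent A z R}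

/-- `M : [a, ∞) → (0, ∞)` has positive increase: there are `α > 0`, `c ∈ (0,1]` and
`s₀ ≥ a` with `s₀ > 0` such that `M (λ s) / M s ≥ c λ^α` for all `λ ≥ 1`, `s ≥ s₀`. -/
def HasPosIncrease (a : ℝ) (M : ℝ → ℝ) : Prop :=
  ∃ α : ℝ, 0 < α ∧ ∃ c : ℝ, c ∈ Set.Ioc (0 : ℝ) 1 ∧ ∃ s₀ : ℝ, a ≤ s₀ ∧ 0 < s₀ ∧
    ∀ lam : ℝ, 1 ≤ lam → ∀ s : ℝ, s₀ ≤ s → c * lam ^ α ≤ M (lam * s) / M s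

/-- The right-continuous right-inverse `M⁻¹ t = sup {r ≥ a : M r ≤ t}` of a
continuous non-decreasing function `M` on `[a, ∞)` with `M s → ∞` as `s → ∞`. -/
def rcInv (a : ℝ) (M : ℝ → ℝ) (t : ℝ) : ℝ :=
  sSup {r : ℝ | a ≤ r ∧ M r ≤ t}

section Plancherel

open FourierTransform SchwartzMap

variable {F : Type*} [NormedAddCommGroup F] [InnerProductSpace ℂ F] [CompleteSpace F]

/-- The `L²`-Fourier transform of an integrable `L²`-function is given by the usual integral. -/
theorem fourier_toLp_ae_eq {f : ℝ → F} (h1 : Integrable f) (h2 : MemLp f 2) :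
    ((𝓕 (h2.toLp f) : Lp F 2) : ℝ → F) =ᵐ[volume] 𝓕 f := by
  have hcont : Continuous (𝓕 f) :=
    VectorFourier.fourierIntegral_continuous Real.continuous_fourierChar
      (L := innerₗ ℝ) continuous_inner h1
  refine ae_eq_of_integral_contDiff_smul_eq
    ((Lp.memLp (𝓕 (h2.toLp f) : Lp F 2 (volume : Measure ℝ))).locallyIntegrable (by norm_num)) hcont.locallyIntegrable fun g hg hgs ↦ ?_
  have hgs' : HasCompactSupport fun t ↦ (g t : ℂ) := hgs.comp_left (g := Complex.ofReal) rfl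
  let φ : 𝓢(ℝ, ℂ) := hgs'.toSchwartzMap (Complex.ofRealCLM.contDiff.comp hg)
  have hφ : ∀ t, φ t = (g t : ℂ) := fun t ↦ rfl
  have key := DFunLike.congr_fun (Lp.fourier_toTemperedDistribution_eq (h2.toLp f)) φ
  rw [TemperedDistribution.fourier_apply, Lp.toTemperedDistribution_apply,
    Lp.toTemperedDistribution_apply] at key
  have e1 : ∫ x, (𝓕 φ) x • (h2.toLp f) x = ∫ x, (𝓕 φ) x • f x := by
    refine integral_congr_ae ?_
    filter_upwards [h2.coeFn_toLp] with x hx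
    rw [hx]
  have e2 : ∫ x, (𝓕 φ) x • f x = ∫ x, φ x • 𝓕 f x := by
    simpa using! VectorFourier.integral_fourierIntegral_smul_eq_flip (L := innerₗ ℝ)
      Real.continuous_fourierChar continuous_inner φ.integrable h1
  rw [e1, e2] at key
  simpa only [hφ, Complex.coe_smul] using key.symm

/-- Plancherel's theorem for integrable `L²`-functions, as an equality of `L²`-seminorms. -/
theorem eLpNorm_fourier_eq {f : ℝ → F} (h1 : Integrable f) (h2 : MemLp f 2) :
    eLpNorm (𝓕 f) 2 = eLpNorm f 2 := by
  rw [← eLpNorm_congr_ae (fourier_toLp_ae_eq h1 h2), ← eLpNorm_congr_ae h2.coeFn_toLp,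
    ← Lp.enorm_def, ← Lp.enorm_def, ← ofReal_norm, ← ofReal_norm, Lp.norm_fourier_eq]

end Plancherel

section Resolvent

variable {X : Type*} [NormedAddCommGroup X] [NormedSpace ℂ X] {A : X →ₗ.[ℂ] X}

theorem IsResolvent.sub_apply {z w : ℂ} {R S : X →L[ℂ] X} (hR : IsResolvent A z R)
    (hS : IsResolvent A w S) (x : X) : R x - S x = (w - z) • R (S x) := by
  have h := hR.left_inv ⟨S x, hS.mem_domain x⟩
  have h' := hS.right_inv x
  have : z • S x - A ⟨S x, hS.mem_domain x⟩ = x + (z - w) • S x := by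
    linear_combination (norm := module) h'
  simp only [this, map_add, map_smul] at h
  linear_combination (norm := module) h

/-- The resolvent identity. -/
theorem IsResolvent.sub_eq {z w : ℂ} {R S : X →L[ℂ] X} (hR : IsResolvent A z R)
    (hS : IsResolvent A w S) : R - S = (w - z) • (R * S) := by
  ext x
  exact hR.sub_apply hS x

theorem IsResolvent.commute {z w : ℂ} {R S : X →L[ℂ] X} (hR : IsResolvent A z R)
    (hS : IsResolvent A w S) : Commute R S := by
  rcases eq_or_ne z w with rfl | hzw
  · have := hR.sub_eq hS
    rw [sub_self, zero_smul, sub_eq_zero] at this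
    rw [this]
  · have h1 := hR.sub_eq hS
    have h2 := hS.sub_eq hR
    have h3 : (w - z) • (R * S) = (w - z) • (S * R) := by
      rw [← h1, ← neg_sub w z, neg_smul] at *
      rw [← neg_eq_iff_eq_neg] at h2
      rw [← h2, neg_sub]
    exact smul_right_injective _ (sub_ne_zero.2 hzw.symm) h3

/-- If `‖w - z‖ * ‖R(z, A)‖ < 1`, then `w` is in the resolvent set. -/
theorem IsResolvent.exists_of_norm_lt [CompleteSpace X] {z : ℂ} {R : X →L[ℂ] X}
    (hR : IsResolvent A z R) {w : ℂ} (h : ‖(z - w) • R‖ < 1) :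
    ∃ S : X →L[ℂ] X, IsResolvent A w S := by
  let u := Units.oneSub _ h
  let V : X →L[ℂ] X := ↑u⁻¹
  have hu : (u : X →L[ℂ] X) = 1 - (z - w) • R := rfl
  have hRu : Commute (u : X →L[ℂ] X) R := by
    rw [hu]
    exact (Commute.one_left R).sub_left ((Commute.refl R).smul_left _)
  have hRV : V * R = R * V := hRu.units_inv_left
  have huV : ∀ x, V x - (z - w) • R (V x) = x := fun x ↦ DFunLike.congr_fun u.mul_inv x
  have hVu : ∀ x, V (x - (z - w) • R x) = x := fun x ↦ DFunLike.congr_fun u.inv_mul x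
  refine ⟨R * V, fun x ↦ hR.mem_domain (V x), fun x ↦ ?_, fun x ↦ ?_⟩
  · have h1 := hR.right_inv (V x)
    have h2 := huV x
    change w • R (V x) - A ⟨R (V x), _⟩ = x
    linear_combination (norm := module) h1 + h2
  · rw [← hRV]
    change V (R (w • (x : X) - A x)) = x
    have h1 := hR.left_inv x
    have h2 := hVu x
    refine Eq.trans (congrArg V ?_) h2
    simp only [map_sub, map_smul] at h1 ⊢
    linear_combination (norm := module) h1

end Resolvent

section Semigroup

variable {X : Type*} [NormedAddCommGroup X] [NormedSpace ℂ X] {T : ℝ → X →L[ℂ] X}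
  {A : X →ₗ.[ℂ] X}

theorem IsGenerator.apply_mem_domain (hT : IsC0Semigroup T) (hA : IsGenerator T A) {t : ℝ}
    (ht : 0 ≤ t) (v : A.domain) :
    ∃ h : T t v ∈ A.domain, A ⟨T t v, h⟩ = T t (A v) := by
  have key : Tendsto (fun h : ℝ ↦ h⁻¹ • (T h (T t v) - T t v)) (𝓝[>] 0) (𝓝 (T t (A v))) := by
    refine (((T t).continuous.tendsto _).comp (hA.tendsto_generator v)).congr' ?_
    filter_upwards [self_mem_nhdsWithin] with h (hh : 0 < h)
    have h1 : T t (T h v) = T h (T t v) := by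
      have h2 := hT.map_add t h ht hh.le
      rw [add_comm, hT.map_add h t hh.le ht] at h2
      exact (DFunLike.congr_fun h2 (v : X)).symm
    simp only [Function.comp_apply]
    rw [← h1, ← map_sub, ← Complex.coe_smul, map_smul, Complex.coe_smul]
  have hm : T t v ∈ A.domain := (hA.mem_domain_iff _).2 ⟨_, key⟩
  exact ⟨hm, tendsto_nhds_unique (hA.tendsto_generator ⟨_, hm⟩) key⟩

theorem IsGenerator.hasDerivWithinAt (hT : IsC0Semigroup T) (hA : IsGenerator T A) {t : ℝ}
    (ht : 0 ≤ t) (v : A.domain) :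
    HasDerivWithinAt (fun s ↦ T s (v : X)) (T t (A v)) (Set.Ioi t) t := by
  rw [hasDerivWithinAt_iff_tendsto_slope' (by simp)]
  have h1 : Tendsto (fun s : ℝ ↦ s - t) (𝓝[>] t) (𝓝[>] 0) := by
    refine tendsto_nhdsWithin_iff.2 ⟨?_, ?_⟩
    · refine Tendsto.mono_left ?_ nhdsWithin_le_nhds
      exact Continuous.tendsto' (by fun_prop) _ _ (by simp)
    · filter_upwards [self_mem_nhdsWithin] with s (hs : t < s)
      exact sub_pos.2 hs
  refine ((((T t).continuous.tendsto _).comp (hA.tendsto_generator v)).comp h1).congr' ?_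
  filter_upwards [self_mem_nhdsWithin] with s (hs : t < s)
  have h2 := hT.map_add t (s - t) ht (sub_pos.2 hs).le
  rw [add_sub_cancel] at h2
  simp only [Function.comp_apply, slope_def_module, h2, ContinuousLinearMap.comp_apply]
  rw [← map_sub, ← Complex.coe_smul, map_smul, Complex.coe_smul]

theorem IsResolvent.apply_semigroup (hT : IsC0Semigroup T) (hA : IsGenerator T A) {z : ℂ}
    {R : X →L[ℂ] X} (hR : IsResolvent A z R) {t : ℝ} (ht : 0 ≤ t) (x : X) :
    R (T t x) = T t (R x) := by
  obtain ⟨h, h'⟩ := hA.apply_mem_domain hT ht ⟨R x, hR.mem_domain x⟩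
  have := hR.left_inv ⟨_, h⟩
  rw [h'] at this
  refine Eq.trans (congrArg R ?_) this
  rw [← map_smul, ← map_sub, hR.right_inv x]

theorem IsC0Semigroup.aestronglyMeasurable (hT : IsC0Semigroup T) (x : X) :
    AEStronglyMeasurable (fun t ↦ T t x) (volume.restrict (Set.Ioi 0)) :=
  ((hT.strong_continuity x).mono Set.Ioi_subset_Ici_self).aestronglyMeasurable measurableSet_Ioi

theorem integrableOn_pow_mul_exp_neg_mul (n : ℕ) {a : ℝ} (ha : 0 < a) :
    IntegrableOn (fun t : ℝ ↦ t ^ n * Real.exp (-a * t)) (Set.Ioi 0) := by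
  have := integrableOn_rpow_mul_exp_neg_mul_rpow (p := 1) (s := n) (b := a)
    (by have : (0 : ℝ) ≤ n := n.cast_nonneg
        linarith) one_pos ha
  simpa using this

theorem norm_laplace_integrand_le {K : ℝ} (hK : ∀ t : ℝ, 0 ≤ t → ‖T t‖ ≤ K) (n : ℕ) (z : ℂ)
    (x : X) {t : ℝ} (ht : 0 ≤ t) :
    ‖((t : ℂ) ^ n * Complex.exp (-z * t)) • T t x‖ ≤
      K * ‖x‖ * (t ^ n * Real.exp (-z.re * t)) := by
  rw [norm_smul, norm_mul, norm_pow, Complex.norm_exp, Complex.norm_real, Real.norm_of_nonneg ht]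
  have h1 : (-z * (t : ℂ)).re = -z.re * t := by simp
  rw [h1, mul_comm]
  gcongr
  exact (T t).le_of_opNorm_le (hK t ht) x

theorem integrableOn_laplace (hT : IsC0Semigroup T) {K : ℝ} (hK : ∀ t : ℝ, 0 ≤ t → ‖T t‖ ≤ K)
    (n : ℕ) {z : ℂ} (hz : 0 < z.re) (x : X) :
    IntegrableOn (fun t : ℝ ↦ ((t : ℂ) ^ n * Complex.exp (-z * t)) • T t x) (Set.Ioi 0) := by
  refine Integrable.mono' ((integrableOn_pow_mul_exp_neg_mul n hz).const_mul (K * ‖x‖)) ?_ ?_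
  · exact (Continuous.aestronglyMeasurable (by fun_prop)).smul (hT.aestronglyMeasurable x)
  · filter_upwards [ae_restrict_mem measurableSet_Ioi] with t (ht : 0 < t)
    exact norm_laplace_integrand_le hK n z x ht.le

variable (T) in
/-- The Laplace-type integral `∫₀^∞ tⁿ e^{-zt} T(t) x dt`. -/
def laplacePow (n : ℕ) (z : ℂ) (x : X) : X :=
  ∫ t in Set.Ioi (0 : ℝ), ((t : ℂ) ^ n * Complex.exp (-z * t)) • T t x

theorem norm_laplacePow_zero_le {K : ℝ} (hK : ∀ t : ℝ, 0 ≤ t → ‖T t‖ ≤ K)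
    {z : ℂ} (hz : 0 < z.re) (x : X) : ‖laplacePow T 0 z x‖ ≤ K / z.re * ‖x‖ := by
  have h1 : ‖laplacePow T 0 z x‖ ≤
      ∫ t in Set.Ioi (0 : ℝ), K * ‖x‖ * (t ^ 0 * Real.exp (-z.re * t)) := by
    refine norm_integral_le_of_norm_le
      ((integrableOn_pow_mul_exp_neg_mul 0 hz).const_mul (K * ‖x‖)) ?_
    filter_upwards [ae_restrict_mem measurableSet_Ioi] with t (ht : 0 < t)
    exact norm_laplace_integrand_le hK 0 z x ht.le
  refine h1.trans_eq ?_
  simp only [pow_zero, one_mul]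
  rw [integral_const_mul, integral_exp_mul_Ioi (by linarith)]
  simp
  ring

theorem laplacePow_add (hT : IsC0Semigroup T) {K : ℝ} (hK : ∀ t : ℝ, 0 ≤ t → ‖T t‖ ≤ K)
    (n : ℕ) {z : ℂ} (hz : 0 < z.re) (x y : X) :
    laplacePow T n z (x + y) = laplacePow T n z x + laplacePow T n z y := by
  simp only [laplacePow, map_add, smul_add]
  exact integral_add (integrableOn_laplace hT hK n hz x) (integrableOn_laplace hT hK n hz y)

theorem laplacePow_smul (n : ℕ) (z c : ℂ) (x : X) :
    laplacePow T n z (c • x) = c • laplacePow T n z x := by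
  simp only [laplacePow, map_smul, smul_comm _ c]
  exact integral_smul _ _

variable [CompleteSpace X]

/-- Integration by parts for the Laplace-type integrals. -/
theorem laplacePow_smul_sub_apply (hT : IsC0Semigroup T) (hA : IsGenerator T A) {K : ℝ}
    (hK : ∀ t : ℝ, 0 ≤ t → ‖T t‖ ≤ K) (n : ℕ) {z : ℂ} (hz : 0 < z.re) (v : A.domain) :
    laplacePow T n z (z • (v : X) - A v) =
      (n : ℂ) • laplacePow T (n - 1) z v + (0 : ℂ) ^ n • (v : X) := by
  let e : ℕ → ℝ → ℂ := fun k t ↦ (t : ℂ) ^ k * Complex.exp (-z * t)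
  let F : ℝ → X := fun t ↦ e n t • T t v
  let F' : ℝ → X := fun t ↦ e n t • T t (A v) + (n * e (n - 1) t - z * e n t) • T t v
  have he : ∀ t : ℝ, HasDerivAt (e n) (n * e (n - 1) t - z * e n t) t := by
    intro t
    have h1 : HasDerivAt (fun s : ℝ ↦ (s : ℂ) ^ n) (n * (t : ℂ) ^ (n - 1)) t := by
      simpa using (hasDerivAt_pow n (t : ℂ)).comp_ofReal
    have h2 : HasDerivAt (fun s : ℝ ↦ Complex.exp (-z * s))
        (Complex.exp (-z * t) * (-z)) t := by
      have h3 : HasDerivAt (fun w : ℂ ↦ -z * w) (-z) (t : ℂ) := by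
        simpa using (hasDerivAt_id (t : ℂ)).const_mul (-z)
      exact h3.cexp.comp_ofReal
    refine (h1.mul h2).congr_deriv ?_
    simp only [e]
    ring
  have hF : ∀ t : ℝ, 0 ≤ t → HasDerivWithinAt F (F' t) (Set.Ioi t) t := fun t ht ↦
    (he t).hasDerivWithinAt.smul (hA.hasDerivWithinAt hT ht v)
  have hint : ∀ k x, IntegrableOn (fun t : ℝ ↦ e k t • T t x) (Set.Ioi 0) := fun k x ↦
    integrableOn_laplace hT hK k hz x
  have hF'eq : F' = fun t ↦ (n : ℂ) • (e (n - 1) t • T t v) - e n t • T t (z • (v : X) - A v) := by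
    ext t
    simp only [F', map_sub, map_smul]
    module
  have hF' : IntegrableOn F' (Set.Ioi 0) := by
    rw [hF'eq]
    exact ((hint (n - 1) v).smul (n : ℂ)).sub (hint n _)
  have hcont : ContinuousOn F (Set.Ici 0) := by
    refine ContinuousOn.smul (Continuous.continuousOn ?_) (hT.strong_continuity v)
    simp only [e]
    fun_prop
  have hlim : Tendsto F atTop (𝓝 0) := by
    have h1 : Tendsto (fun t : ℝ ↦ K * ‖(v : X)‖ * (t ^ n * Real.exp (-z.re * t))) atTop (𝓝 0) := by
      have h2 := tendsto_rpow_mul_exp_neg_mul_atTop_nhds_zero n z.re hz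
      simpa using h2.const_mul (K * ‖(v : X)‖)
    refine squeeze_zero_norm' ?_ h1
    filter_upwards [eventually_ge_atTop 0] with t ht
    exact norm_laplace_integrand_le hK n z v ht
  have h1 : Tendsto (fun b ↦ ∫ t in (0 : ℝ)..b, F' t) atTop (𝓝 (∫ t in Set.Ioi 0, F' t)) :=
    intervalIntegral_tendsto_integral_Ioi 0 hF' tendsto_id
  have h2 : Tendsto (fun b ↦ ∫ t in (0 : ℝ)..b, F' t) atTop (𝓝 (0 - F 0)) := by
    refine (hlim.sub_const (F 0)).congr' ?_
    filter_upwards [eventually_ge_atTop 0] with b hb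
    refine (intervalIntegral.integral_eq_sub_of_hasDeriv_right_of_le hb
      (hcont.mono Set.Icc_subset_Ici_self) (fun t ht ↦ hF t ht.1.le) ?_).symm
    rw [intervalIntegrable_iff_integrableOn_Ioc_of_le hb]
    exact hF'.mono_set Set.Ioc_subset_Ioi_self
  have h3 := tendsto_nhds_unique h1 h2
  have h4 : F 0 = (0 : ℂ) ^ n • (v : X) := by
    simp [F, e, hT.map_zero]
  have h5 : ∫ t in Set.Ioi 0, F' t =
      (n : ℂ) • laplacePow T (n - 1) z v - laplacePow T n z (z • (v : X) - A v) := by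
    rw [hF'eq]
    refine (integral_sub ((hint (n - 1) v).smul (n : ℂ)) (hint n _)).trans ?_
    exact congrArg (· - _) (integral_smul _ _)
  rw [h5, h4] at h3
  linear_combination (norm := module) -h3

/-- The open right half-plane is contained in the resolvent set of the generator of a bounded
semigroup, and powers of the resolvent are given by Laplace-type integrals. -/
theorem IsGenerator.exists_isResolvent (hT : IsC0Semigroup T) (hA : IsGenerator T A) {K : ℝ}
    (hK : ∀ t : ℝ, 0 ≤ t → ‖T t‖ ≤ K) {R₁ : X →L[ℂ] X} (hR₁ : IsResolvent A 1 R₁)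
    {z : ℂ} (hz : 0 < z.re) :
    ∃ R : X →L[ℂ] X, IsResolvent A z R ∧ ‖R‖ ≤ K / z.re ∧
      ∀ (n : ℕ) (x : X), laplacePow T n z x = (n.factorial : ℂ) • (R ^ (n + 1)) x := by
  have hK0 : 0 ≤ K := (norm_nonneg _).trans (hK 0 le_rfl)
  let R : X →L[ℂ] X := LinearMap.mkContinuous
    { toFun := laplacePow T 0 z
      map_add' := laplacePow_add hT hK 0 hz
      map_smul' := laplacePow_smul 0 z } (K / z.re) (norm_laplacePow_zero_le hK hz)
  have hR : ∀ x, R x = laplacePow T 0 z x := fun x ↦ rfl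
  have hleft : ∀ v : A.domain, R (z • (v : X) - A v) = v := fun v ↦ by
    rw [hR, laplacePow_smul_sub_apply hT hA hK 0 hz v]
    simp
  have hcomm : ∀ x, R (R₁ x) = R₁ (R x) := fun x ↦ by
    rw [hR, hR, laplacePow, laplacePow, ← R₁.integral_comp_comm (integrableOn_laplace hT hK 0 hz x)]
    refine setIntegral_congr_fun measurableSet_Ioi fun t (ht : 0 < t) ↦ ?_
    simp only [map_smul, hR₁.apply_semigroup hT hA ht.le]
  have hrange : ∀ x, R x = R₁ (x - (z - 1) • R x) := fun x ↦ by
    have h1 := hR₁.right_inv x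
    have h2 := hleft ⟨R₁ x, hR₁.mem_domain x⟩
    have h3 : z • R₁ x - A ⟨R₁ x, hR₁.mem_domain x⟩ = x + (z - 1) • R₁ x := by
      linear_combination (norm := module) h1
    simp only [h3, map_add, map_smul, hcomm] at h2
    simp only [map_sub, map_smul]
    linear_combination (norm := module) h2
  have hmem : ∀ x, R x ∈ A.domain := fun x ↦ by
    rw [hrange]
    exact hR₁.mem_domain _
  have hright : ∀ x, z • R x - A ⟨R x, hmem x⟩ = x := fun x ↦ by
    have h1 := hR₁.right_inv (x - (z - 1) • R x)
    have h2 : A ⟨R₁ (x - (z - 1) • R x), hR₁.mem_domain _⟩ = A ⟨R x, hmem x⟩ := by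
      congr 2
      exact (hrange x).symm
    rw [h2, ← hrange] at h1
    linear_combination (norm := module) h1
  refine ⟨R, ⟨hmem, hright, hleft⟩, LinearMap.mkContinuous_norm_le _ (div_nonneg hK0 hz.le) _,
    fun n ↦ ?_⟩
  induction n with
  | zero => simp [hR]
  | succ n ih =>
    intro x
    have h1 := laplacePow_smul_sub_apply hT hA hK (n + 1) hz ⟨R x, hmem x⟩
    rw [hright x] at h1
    rw [h1, Nat.add_sub_cancel, ih, smul_smul, pow_succ R (n + 1), Nat.factorial_succ]
    simp

end Semigroup

section Decay

open FourierTransform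

theorem integral_norm_sq_le_of_norm_fourier_le {F : Type*} [NormedAddCommGroup F]
    [InnerProductSpace ℂ F] [CompleteSpace F] {f g : ℝ → F} (hf : Integrable f)
    (hf' : MemLp f 2) (hg : Integrable g) (hg' : MemLp g 2) {D : ℝ} (hD : 0 ≤ D)
    (h : ∀ᵐ ξ : ℝ, ‖𝓕 g ξ‖ ≤ D * ‖𝓕 f ξ‖) :
    ∫ t, ‖g t‖ ^ 2 ≤ D ^ 2 * ∫ t, ‖f t‖ ^ 2 := by
  have h1 := eLpNorm_le_mul_eLpNorm_of_ae_le_mul h 2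
  rw [eLpNorm_fourier_eq hf hf', eLpNorm_fourier_eq hg hg',
    hf'.eLpNorm_eq_integral_rpow_norm two_ne_zero ENNReal.ofNat_ne_top,
    hg'.eLpNorm_eq_integral_rpow_norm two_ne_zero ENNReal.ofNat_ne_top,
    ← ENNReal.ofReal_mul hD, ENNReal.ofReal_le_ofReal_iff (by positivity)] at h1
  simp only [ENNReal.toReal_ofNat, Real.rpow_ofNat, ← one_div, ← Real.sqrt_eq_rpow] at h1
  have h2 : (0 : ℝ) ≤ ∫ t, ‖f t‖ ^ 2 := integral_nonneg fun t ↦ by positivity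
  rw [← Real.sqrt_sq hD, ← Real.sqrt_mul (sq_nonneg D)] at h1
  exact (Real.sqrt_le_sqrt_iff (by positivity)).1 h1

theorem integrable_indicator_pow_mul_exp (c : ℝ) (n : ℕ) {a : ℝ} (ha : 0 < a) :
    Integrable ((Set.Ioi (0 : ℝ)).indicator
      (fun t ↦ c * (t ^ (2 * n) * Real.exp (-(2 * a) * t)))) := by
  rw [integrable_indicator_iff measurableSet_Ioi]
  exact (integrableOn_pow_mul_exp_neg_mul (2 * n) (by linarith)).const_mul _

section Orbit

variable {X : Type*} [NormedAddCommGroup X] [NormedSpace ℂ X] {T : ℝ → X →L[ℂ] X}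

variable (T) in
/-- The function `t ↦ tⁿ e^{-at} T(t) x`, extended by zero to `t ≤ 0`. -/
def weightedOrbit (n : ℕ) (a : ℝ) (x : X) : ℝ → X :=
  (Set.Ioi (0 : ℝ)).indicator fun t ↦ ((t : ℂ) ^ n * Complex.exp (-(a : ℂ) * t)) • T t x

theorem norm_weightedOrbit_sq (n : ℕ) (a : ℝ) (x : X) {t : ℝ} (ht : 0 < t) :
    ‖weightedOrbit T n a x t‖ ^ 2 = t ^ (2 * n) * Real.exp (-(2 * a) * t) * ‖T t x‖ ^ 2 := by
  have h1 : (-(a : ℂ) * (t : ℂ)).re = -a * t := by simp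
  rw [weightedOrbit, Set.indicator_of_mem (Set.mem_Ioi.2 ht), norm_smul, norm_mul, norm_pow,
    Complex.norm_exp, Complex.norm_real, Real.norm_of_nonneg ht.le, h1, mul_pow, mul_pow,
    ← Real.exp_nat_mul, ← pow_mul]
  ring_nf

theorem norm_weightedOrbit_sq_of_nonpos (n : ℕ) (a : ℝ) (x : X) {t : ℝ} (ht : t ≤ 0) :
    ‖weightedOrbit T n a x t‖ ^ 2 = 0 := by
  rw [weightedOrbit, Set.indicator_of_notMem (by simpa using ht)]
  simp

theorem integrable_weightedOrbit (hT : IsC0Semigroup T) {K : ℝ}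
    (hK : ∀ t : ℝ, 0 ≤ t → ‖T t‖ ≤ K) (n : ℕ) {a : ℝ} (ha : 0 < a) (x : X) :
    Integrable (weightedOrbit T n a x) := by
  rw [weightedOrbit, integrable_indicator_iff measurableSet_Ioi]
  exact integrableOn_laplace hT hK n (by simpa using ha) x

theorem norm_weightedOrbit_sq_le {K : ℝ} (hK : ∀ t : ℝ, 0 ≤ t → ‖T t‖ ≤ K) (n : ℕ) (a : ℝ) (x : X)
    (t : ℝ) : ‖weightedOrbit T n a x t‖ ^ 2 ≤ (Set.Ioi (0 : ℝ)).indicator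
      (fun t ↦ (K * ‖x‖) ^ 2 * (t ^ (2 * n) * Real.exp (-(2 * a) * t))) t := by
  rcases le_or_gt t 0 with ht | ht
  · rw [norm_weightedOrbit_sq_of_nonpos n a x ht, Set.indicator_of_notMem (by simpa using ht)]
  · rw [norm_weightedOrbit_sq n a x ht, Set.indicator_of_mem (Set.mem_Ioi.2 ht), mul_comm]
    gcongr
    exact (T t).le_of_opNorm_le (hK t ht.le) x

theorem memLp_weightedOrbit (hT : IsC0Semigroup T) {K : ℝ}
    (hK : ∀ t : ℝ, 0 ≤ t → ‖T t‖ ≤ K) (n : ℕ) {a : ℝ} (ha : 0 < a) (x : X) :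
    MemLp (weightedOrbit T n a x) 2 := by
  have hm := (integrable_weightedOrbit hT hK n ha x).aestronglyMeasurable
  rw [memLp_two_iff_integrable_sq_norm hm]
  refine (integrable_indicator_pow_mul_exp ((K * ‖x‖) ^ 2) n ha).mono' (hm.norm.pow 2) (ae_of_all _ fun t ↦ ?_)
  rw [Real.norm_of_nonneg (by positivity)]
  exact norm_weightedOrbit_sq_le hK n a x t

theorem fourier_weightedOrbit (n : ℕ) (a : ℝ) (x : X) (ξ : ℝ) :
    𝓕 (weightedOrbit T n a x) ξ =
      laplacePow T n ((a : ℂ) + Complex.I * ((2 * Real.pi * ξ : ℝ) : ℂ)) x := by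
  rw [Real.fourier_real_eq_integral_exp_smul, laplacePow, ← integral_indicator measurableSet_Ioi]
  congr 1
  ext t
  by_cases ht : t ∈ Set.Ioi (0 : ℝ)
  · rw [weightedOrbit, Set.indicator_of_mem ht, Set.indicator_of_mem ht, smul_smul,
      mul_left_comm, ← Complex.exp_add]
    congr 3
    push_cast
    ring
  · rw [weightedOrbit, Set.indicator_of_notMem ht, Set.indicator_of_notMem ht, smul_zero]

theorem integral_norm_weightedOrbit_zero_sq_le {K : ℝ}
    (hK : ∀ t : ℝ, 0 ≤ t → ‖T t‖ ≤ K) {a : ℝ} (ha : 0 < a) (x : X) :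
    ∫ t, ‖weightedOrbit T 0 a x t‖ ^ 2 ≤ (K * ‖x‖) ^ 2 / (2 * a) := by
  have h1 : ∫ t, ‖weightedOrbit T 0 a x t‖ ^ 2 ≤ ∫ t, (Set.Ioi (0 : ℝ)).indicator
      (fun t ↦ (K * ‖x‖) ^ 2 * (t ^ (2 * 0) * Real.exp (-(2 * a) * t))) t :=
    integral_mono_of_nonneg (ae_of_all _ fun t ↦ by positivity)
      (integrable_indicator_pow_mul_exp _ 0 ha)
      (ae_of_all _ (norm_weightedOrbit_sq_le hK 0 a x))
  refine h1.trans_eq ?_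
  rw [integral_indicator measurableSet_Ioi]
  simp only [mul_zero, pow_zero, one_mul]
  rw [integral_const_mul, integral_exp_mul_Ioi (by linarith)]
  simp
  ring

theorem le_integral_norm_weightedOrbit_sq (hT : IsC0Semigroup T) {K : ℝ} (hK0 : 0 < K)
    (hK : ∀ t : ℝ, 0 ≤ t → ‖T t‖ ≤ K) (n : ℕ) {τ : ℝ} (hτ : 0 < τ) (y : X) :
    τ ^ (2 * n + 1) / (2 * n + 1) * (Real.exp (-2) * (‖T τ y‖ / K) ^ 2) ≤
      ∫ t, ‖weightedOrbit T n τ⁻¹ y t‖ ^ 2 := by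
  have hi : Integrable fun t ↦ ‖weightedOrbit T n τ⁻¹ y t‖ ^ 2 :=
    (memLp_two_iff_integrable_sq_norm
      (integrable_weightedOrbit hT hK n (inv_pos.2 hτ) y).aestronglyMeasurable).1
      (memLp_weightedOrbit hT hK n (inv_pos.2 hτ) y)
  have h1 : ∫ t in Set.Ioc 0 τ, t ^ (2 * n) * (Real.exp (-2) * (‖T τ y‖ / K) ^ 2) ≤
      ∫ t in Set.Ioc 0 τ, ‖weightedOrbit T n τ⁻¹ y t‖ ^ 2 := by
    refine setIntegral_mono_on ?_ hi.integrableOn measurableSet_Ioc fun t ht ↦ ?_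
    · exact (Continuous.integrableOn_Icc (by fun_prop)).mono_set Set.Ioc_subset_Icc_self
    · rw [norm_weightedOrbit_sq n _ y ht.1, mul_assoc]
      have h2 : ‖T τ y‖ / K ≤ ‖T t y‖ := by
        rw [div_le_iff₀' hK0]
        have h3 := hT.map_add (τ - t) t (sub_nonneg.2 ht.2) ht.1.le
        rw [sub_add_cancel] at h3
        rw [h3]
        exact (T (τ - t)).le_of_opNorm_le (hK _ (sub_nonneg.2 ht.2)) _
      have h3 : (-2 : ℝ) ≤ -(2 * τ⁻¹) * t := by
        have : τ⁻¹ * t ≤ 1 := by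
          rw [inv_mul_le_iff₀ hτ]
          simpa using ht.2
        linarith
      have := ht.1
      gcongr
  refine le_trans (le_of_eq ?_) (h1.trans (setIntegral_le_integral hi
    (ae_of_all _ fun t ↦ by positivity)))
  rw [integral_mul_const, ← intervalIntegral.integral_of_le hτ.le, integral_pow]
  simp

end Orbit

variable {X : Type*} [NormedAddCommGroup X] [InnerProductSpace ℂ X] [CompleteSpace X]
  {T : ℝ → X →L[ℂ] X} {A : X →ₗ.[ℂ] X}

/-- A bound for `B R(τ⁻¹ + is, A)ⁿ` which is uniform in `s ≠ 0` gives a bound for `T(τ) B`. -/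
theorem IsGenerator.norm_comp_le_of_resolvent_pow_le (hT : IsC0Semigroup T)
    (hA : IsGenerator T A) {K : ℝ} (hK0 : 0 < K) (hK : ∀ t : ℝ, 0 ≤ t → ‖T t‖ ≤ K)
    {R₁ : X →L[ℂ] X} (hR₁ : IsResolvent A 1 R₁) {B : X →L[ℂ] X}
    (hB : ∀ (z : ℂ) (R : X →L[ℂ] X), IsResolvent A z R → Commute B R)
    {n : ℕ} {τ D : ℝ} (hτ : 0 < τ) (hD : 0 ≤ D)
    (h : ∀ (s : ℝ) (R : X →L[ℂ] X), s ≠ 0 →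
      IsResolvent A (((τ⁻¹ : ℝ) : ℂ) + Complex.I * (s : ℂ)) R → ‖R‖ ≤ K * τ → ‖B * R ^ n‖ ≤ D) :
    ‖T τ ∘L B‖ ≤ Real.exp 1 * K ^ 2 * (2 * n + 1) * n.factorial * (D / τ ^ n) := by
  have ha : 0 < τ⁻¹ := inv_pos.2 hτ
  refine ContinuousLinearMap.opNorm_le_bound _ (by positivity) fun x ↦ ?_
  have h1 : ∀ᵐ ξ : ℝ, ‖𝓕 (weightedOrbit T n τ⁻¹ (B x)) ξ‖ ≤
      (n.factorial * D) * ‖𝓕 (weightedOrbit T 0 τ⁻¹ x) ξ‖ := by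
    filter_upwards [Measure.ae_ne volume (0 : ℝ)] with ξ hξ
    rw [fourier_weightedOrbit, fourier_weightedOrbit]
    have hre : ((((τ⁻¹ : ℝ) : ℂ) + Complex.I * ((2 * Real.pi * ξ : ℝ) : ℂ))).re = τ⁻¹ := by
      simp [-Complex.ofReal_mul, -Complex.ofReal_inv]
    obtain ⟨R, hR, hRn, hL⟩ := hA.exists_isResolvent hT hK hR₁ (hre.symm ▸ ha)
    rw [hre, div_inv_eq_mul] at hRn
    have h2 := h (2 * Real.pi * ξ) R (by positivity) hR hRn
    have h3 : (R ^ (n + 1)) (B x) = (B * R ^ n) (R x) := by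
      have h4 : R ^ (n + 1) * B = B * R ^ n * R := by
        rw [mul_assoc, ← pow_succ]
        exact ((hB _ R hR).pow_right _).eq.symm
      exact DFunLike.congr_fun h4 x
    rw [hL, hL, h3, norm_smul, norm_smul, mul_assoc]
    simp only [Complex.norm_natCast, zero_add, pow_one, Nat.factorial_zero, Nat.cast_one,
      norm_one, one_mul]
    gcongr
    exact (B * R ^ n).le_of_opNorm_le h2 _
  have h2 := integral_norm_sq_le_of_norm_fourier_le
    (integrable_weightedOrbit hT hK 0 ha x) (memLp_weightedOrbit hT hK 0 ha x)
    (integrable_weightedOrbit hT hK n ha (B x)) (memLp_weightedOrbit hT hK n ha (B x))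
    (by positivity) h1
  have h3 := (le_integral_norm_weightedOrbit_sq hT hK0 hK n hτ (B x)).trans (h2.trans
    (mul_le_mul_of_nonneg_left (integral_norm_weightedOrbit_zero_sq_le hK ha x) (by positivity)))
  change ‖T τ (B x)‖ ≤ _
  refine le_of_sq_le_sq ?_ (by positivity)
  have hexp : Real.exp (-2) = (Real.exp 1 ^ 2)⁻¹ := by
    rw [← Real.exp_nat_mul, ← Real.exp_neg]
    norm_num
  have h4 : ‖T τ (B x)‖ ^ 2 = (τ ^ (2 * n + 1) / (2 * n + 1) *
      (Real.exp (-2) * (‖T τ (B x)‖ / K) ^ 2)) *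
      (Real.exp 1 ^ 2 * K ^ 2 * (2 * n + 1) / τ ^ (2 * n + 1)) := by
    rw [hexp]
    field_simp
  rw [h4]
  refine (mul_le_mul_of_nonneg_right h3 (by positivity)).trans ?_
  have h5 : (n.factorial * D) ^ 2 * ((K * ‖x‖) ^ 2 / (2 * τ⁻¹)) *
      (Real.exp 1 ^ 2 * K ^ 2 * (2 * n + 1) / τ ^ (2 * n + 1)) =
      (Real.exp 1 * K ^ 2 * n.factorial * (D / τ ^ n) * ‖x‖) ^ 2 * ((2 * n + 1) / 2) := by
    field_simp
    ring
  have h6 : (Real.exp 1 * K ^ 2 * (2 * n + 1) * n.factorial * (D / τ ^ n) * ‖x‖) ^ 2 =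
      (Real.exp 1 * K ^ 2 * n.factorial * (D / τ ^ n) * ‖x‖) ^ 2 * (2 * n + 1) ^ 2 := by
    ring
  rw [h5, h6]
  gcongr
  have : (0 : ℝ) ≤ n := n.cast_nonneg
  nlinarith

end Decay

section Auxiliary

variable {X : Type*} [NormedAddCommGroup X] [NormedSpace ℂ X] {A : X →ₗ.[ℂ] X}

theorem IsResolvent.sub_one_mul_pow {z : ℂ} {R₁ R : X →L[ℂ] X} (hR₁ : IsResolvent A 1 R₁)
    (hR : IsResolvent A z R) (m : ℕ) :
    (R₁ - 1) * R ^ (m + 1) = z • (R₁ * R ^ (m + 1)) - R₁ * R ^ m := by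
  have h1 : (R₁ - 1) * R = z • (R₁ * R) - R₁ := by
    rw [sub_mul, one_mul]
    linear_combination (norm := module) hR₁.sub_eq hR
  rw [pow_succ', ← mul_assoc, h1, sub_mul, smul_mul_assoc, mul_assoc]

theorem norm_mul_pow_le (S R : X →L[ℂ] X) (n : ℕ) : ‖S * R ^ n‖ ≤ ‖S‖ * ‖R‖ ^ n := by
  induction n with
  | zero => simp
  | succ n ih =>
    rw [pow_succ, ← mul_assoc, pow_succ, ← mul_assoc]
    exact (norm_mul_le _ _).trans (by gcongr)

theorem IsResolvent.norm_sub_one_mul_pow_le {z : ℂ} {R₁ R : X →L[ℂ] X}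
    (hR₁ : IsResolvent A 1 R₁) (hR : IsResolvent A z R) (m : ℕ) :
    ‖(R₁ - 1) * R ^ (m + 1)‖ ≤ ‖R₁‖ * (‖z‖ * ‖R‖ ^ (m + 1) + ‖R‖ ^ m) := by
  rw [hR₁.sub_one_mul_pow hR]
  refine (norm_sub_le _ _).trans ?_
  rw [norm_smul]
  have h1 := norm_mul_pow_le R₁ R (m + 1)
  have h2 := norm_mul_pow_le R₁ R m
  nlinarith [mul_le_mul_of_nonneg_left h1 (norm_nonneg z)]

/-- Moving from the imaginary axis into the right half-plane. -/
theorem IsResolvent.norm_le_of_imaginary {K τ s : ℝ} (hτ : 0 < τ) {P R : X →L[ℂ] X}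
    (hP : IsResolvent A (Complex.I * (s : ℂ)) P)
    (hR : IsResolvent A (((τ⁻¹ : ℝ) : ℂ) + Complex.I * (s : ℂ)) R) (hRn : ‖R‖ ≤ K * τ) :
    ‖R‖ ≤ (1 + K) * ‖P‖ := by
  have h1 := hR.sub_eq hP
  have h2 : Complex.I * (s : ℂ) - (((τ⁻¹ : ℝ) : ℂ) + Complex.I * (s : ℂ)) =
      ((-τ⁻¹ : ℝ) : ℂ) := by
    push_cast
    ring
  rw [h2, sub_eq_iff_eq_add] at h1
  have h3 : ‖((-τ⁻¹ : ℝ) : ℂ) • (R * P)‖ ≤ K * ‖P‖ := by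
    rw [norm_smul, Complex.norm_real, norm_neg, Real.norm_of_nonneg (by positivity)]
    calc τ⁻¹ * ‖R * P‖ ≤ τ⁻¹ * (K * τ * ‖P‖) := by
          gcongr
          exact (norm_mul_le _ _).trans (by gcongr)
      _ = K * ‖P‖ := by field_simp
  have h4 := norm_add_le (((-τ⁻¹ : ℝ) : ℂ) • (R * P)) P
  rw [← h1] at h4
  linarith

theorem rcInv_mem {a : ℝ} {M : ℝ → ℝ} (hM : ContinuousOn M (Set.Ici a))
    (hle : ∀ s, a ≤ s → s ≤ M s) {t : ℝ} (ht : M a ≤ t) :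
    a ≤ rcInv a M t ∧ M (rcInv a M t) ≤ t := by
  have hclosed : IsClosed {r : ℝ | a ≤ r ∧ M r ≤ t} :=
    hM.preimage_isClosed_of_isClosed isClosed_Ici isClosed_Iic
  exact hclosed.csSup_mem ⟨a, le_rfl, ht⟩ ⟨t, fun r hr ↦ (hle r hr.1).trans hr.2⟩

/-- Functions of positive increase satisfy `r M(r⁻¹)ⁿ ≲ M(σ)ⁿ / σ` for `σ⁻¹ ≤ r ≤ 1` and all
large `n`. -/
theorem HasPosIncrease.exists_mul_pow_le {M : ℝ → ℝ} (hpi : HasPosIncrease 1 M)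
    (hpos : ∀ s : ℝ, 1 ≤ s → 0 < M s) (hmono : ∀ s t : ℝ, 1 ≤ s → s ≤ t → M s ≤ M t) :
    ∃ (m : ℕ) (C : ℝ), 0 ≤ C ∧ ∀ τ σ r : ℝ, 1 ≤ σ → σ ≤ τ → M σ ≤ τ → σ⁻¹ ≤ r → r ≤ 1 →
      r * M r⁻¹ ^ (m + 1) ≤ C * (τ ^ (m + 1) / σ) := by
  obtain ⟨α, hα, c, ⟨hc, -⟩, s₀, hs₀, hs₀', h⟩ := hpi
  obtain ⟨m, hm⟩ := exists_nat_ge α⁻¹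
  have hs₀M := hpos s₀ hs₀
  refine ⟨m, (c⁻¹) ^ (m + 1) + M s₀ ^ (m + 1), by positivity, ?_⟩
  intro τ σ r hσ hστ hMσ hσr hr
  have hσ0 : 0 < σ := by linarith
  have hτ0 : 0 < τ := by linarith
  have hr0 : 0 < r := (inv_pos.2 hσ0).trans_le hσr
  have hr1 : 1 ≤ r⁻¹ := (one_le_inv₀ hr0).2 hr
  have hMr := hpos r⁻¹ hr1
  have hnn : 0 ≤ τ ^ (m + 1) / σ := by positivity
  rw [add_mul]
  rcases le_total s₀ r⁻¹ with hs | hs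
  · have hlam : 1 ≤ σ * r := (inv_le_iff_one_le_mul₀' hσ0).1 hσr
    have h1 := h (σ * r) hlam r⁻¹ hs
    rw [mul_assoc, mul_inv_cancel₀ hr0.ne', mul_one, le_div_iff₀ hMr] at h1
    have h2 : σ * r ≤ ((σ * r) ^ α) ^ (m + 1) := by
      rw [← Real.rpow_natCast, ← Real.rpow_mul (by positivity)]
      have h3 : 1 ≤ α * ((m + 1 : ℕ) : ℝ) := by
        rw [inv_le_iff_one_le_mul₀' hα] at hm
        push_cast
        nlinarith
      simpa using Real.rpow_le_rpow_of_exponent_le hlam h3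
    have h4 : (σ * r) * (c * M r⁻¹) ^ (m + 1) ≤ τ ^ (m + 1) := by
      calc (σ * r) * (c * M r⁻¹) ^ (m + 1)
          ≤ ((σ * r) ^ α) ^ (m + 1) * (c * M r⁻¹) ^ (m + 1) := by gcongr
        _ = (c * (σ * r) ^ α * M r⁻¹) ^ (m + 1) := by rw [← mul_pow]; ring
        _ ≤ τ ^ (m + 1) := by gcongr; exact h1.trans hMσ
    have h5 : r * M r⁻¹ ^ (m + 1) ≤ c⁻¹ ^ (m + 1) * (τ ^ (m + 1) / σ) := by
      rw [inv_pow, ← div_eq_inv_mul, div_div, le_div_iff₀ (by positivity)]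
      refine le_trans (le_of_eq ?_) h4
      rw [mul_pow]
      ring
    have : 0 ≤ M s₀ ^ (m + 1) * (τ ^ (m + 1) / σ) := by positivity
    linarith
  · have h1 : 1 ≤ τ ^ (m + 1) / σ := by
      rw [le_div_iff₀ hσ0, one_mul]
      exact hστ.trans (le_self_pow₀ (hσ.trans hστ) (by simp))
    have h2 : M r⁻¹ ^ (m + 1) ≤ M s₀ ^ (m + 1) := by
      gcongr
      exact hmono _ _ hr1 hs
    have h3 : r * M r⁻¹ ^ (m + 1) ≤ M s₀ ^ (m + 1) := by
      have : 0 ≤ M r⁻¹ ^ (m + 1) := by positivity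
      nlinarith
    have h4 : M s₀ ^ (m + 1) ≤ M s₀ ^ (m + 1) * (τ ^ (m + 1) / σ) :=
      le_mul_of_one_le_right (by positivity) h1
    have : 0 ≤ c⁻¹ ^ (m + 1) * (τ ^ (m + 1) / σ) := by positivity
    linarith

end Auxiliary

/-- Let `X` be a complex Hilbert space and `A` the generator of a bounded
`C₀`-semigroup `(T(t))` on `X`. Suppose `σ(A) ∩ iℝ = {0}`, that `sup_{|s| ≥ 1} ‖R(i s, A)‖ < ∞`,
and that `M : [1,∞) → (0,∞)` is a continuous non-decreasing function of positive increase with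
`sup_{s⁻¹ ≤ |r| ≤ 1} ‖R(i r, A)‖ ≤ M s` for all `s ≥ 1`. Then
`‖T(t) A R(1,A)‖ = O(1 / M⁻¹ t)` as `t → ∞`. (Note `A R(1,A) = R(1,A) - I`.) -/
theorem statement5 {X : Type*} [NormedAddCommGroup X] [InnerProductSpace ℂ X]
    [CompleteSpace X]
    (T : ℝ → X →L[ℂ] X) (hT : IsC0Semigroup T)
    (hTbdd : ∃ K : ℝ, ∀ t : ℝ, 0 ≤ t → ‖T t‖ ≤ K)
    (A : X →ₗ.[ℂ] X) (hA : IsGenerator T A)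
    (hspec : pmSpectrum A ∩ {z : ℂ | z.re = 0} = {0})
    (Rop : ℝ → X →L[ℂ] X)
    (hRop : ∀ r : ℝ, r ≠ 0 → IsResolvent A (Complex.I * (r : ℂ)) (Rop r))
    (R1 : X →L[ℂ] X) (hR1 : IsResolvent A 1 R1)
    (hresbdd : ∃ B : ℝ, ∀ r : ℝ, 1 ≤ |r| → ‖Rop r‖ ≤ B)
    (M : ℝ → ℝ)
    (hMpos : ∀ s : ℝ, 1 ≤ s → 0 < M s)
    (hMcont : ContinuousOn M (Set.Ici (1 : ℝ)))
    (hMmono : ∀ s t : ℝ, 1 ≤ s → s ≤ t → M s ≤ M t)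
    (hMpi : HasPosIncrease 1 M)
    (hres : ∀ s : ℝ, 1 ≤ s → ∀ r : ℝ, s⁻¹ ≤ |r| → |r| ≤ 1 → ‖Rop r‖ ≤ M s) :
    ∃ C : ℝ, 0 < C ∧ ∃ t₀ : ℝ, ∀ t : ℝ, t₀ ≤ t →
      ‖T t ∘L (R1 - 1)‖ ≤ C / rcInv 1 M t := by
  obtain ⟨K₀, hK₀⟩ := hTbdd
  obtain ⟨B, hB⟩ := hresbdd
  have hB0 : 0 ≤ B := (norm_nonneg _).trans (hB 1 (by simp))
  let K := max K₀ 1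
  have hK0 : 0 < K := lt_max_of_lt_right one_pos
  have hK : ∀ t : ℝ, 0 ≤ t → ‖T t‖ ≤ K := fun t ht ↦ (hK₀ t ht).trans (le_max_left _ _)
  have hzero : ¬∃ S : X →L[ℂ] X, IsResolvent A 0 S :=
    (hspec.symm ▸ Set.mem_singleton (0 : ℂ) : (0 : ℂ) ∈ pmSpectrum A ∩ {z : ℂ | z.re = 0}).1
  have hMle : ∀ s : ℝ, 1 ≤ s → s ≤ M s := by
    intro s hs
    by_contra! hlt
    have hs0 : 0 < s := by linarith
    have habs : |s⁻¹| = s⁻¹ := abs_of_pos (inv_pos.2 hs0)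
    refine hzero ((hRop s⁻¹ (inv_ne_zero hs0.ne')).exists_of_norm_lt ?_)
    have h1 := hres s hs s⁻¹ habs.ge (habs.le.trans (inv_le_one_of_one_le₀ hs))
    rw [sub_zero, norm_smul, norm_mul, Complex.norm_I, one_mul, Complex.norm_real, Real.norm_eq_abs,
      habs, inv_mul_lt_iff₀ hs0, mul_one]
    exact h1.trans_lt hlt
  obtain ⟨m, Q, hQ0, hQ⟩ := hMpi.exists_mul_pow_le hMpos hMmono
  let n := m + 1
  let L := 1 + K
  let C₁ := ‖R1‖ * (L ^ n * Q + 2 * K ^ n + K ^ m)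
  let C₂ := (‖R1‖ + 1) * (L * B) ^ n
  have hL0 : 0 < L := by positivity
  have hC₁ : 0 ≤ C₁ := by positivity
  have hC₂ : 0 ≤ C₂ := by positivity
  let C₃ := Real.exp 1 * K ^ 2 * (2 * n + 1) * n.factorial
  refine ⟨C₃ * (C₁ + C₂) + 1, by positivity, M 1, fun τ hτ ↦ ?_⟩
  obtain ⟨hσ, hMσ⟩ := rcInv_mem hMcont hMle hτ
  set σ := rcInv 1 M τ
  have hσ0 : 0 < σ := by linarith
  have hστ : σ ≤ τ := (hMle σ hσ).trans hMσ
  have hτ0 : 0 < τ := by linarith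
  let E := τ ^ n / σ
  have hE0 : 0 < E := by positivity
  have hE1 : 1 ≤ E := by
    rw [le_div_iff₀ hσ0, one_mul]
    exact hστ.trans (le_self_pow₀ (hσ.trans hστ) (by simp [n]))
  have hτE : τ ^ m ≤ E := by
    rw [le_div_iff₀ hσ0]
    exact (mul_le_mul_of_nonneg_left hστ (by positivity)).trans_eq (pow_succ τ m).symm
  have hcomm : ∀ (z : ℂ) (R : X →L[ℂ] X), IsResolvent A z R → Commute (R1 - 1) R :=
    fun z R hR ↦ (hR1.commute hR).sub_left (Commute.one_left R)
  have hbound : ∀ (s : ℝ) (R : X →L[ℂ] X), s ≠ 0 →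
      IsResolvent A (((τ⁻¹ : ℝ) : ℂ) + Complex.I * (s : ℂ)) R → ‖R‖ ≤ K * τ →
      ‖(R1 - 1) * R ^ n‖ ≤ (C₁ + C₂) * E := by
    intro s R hs hR hRn
    have hRP := (hRop s hs).norm_le_of_imaginary hτ0 hR hRn
    rcases le_total |s| 1 with hs1 | hs1
    · have h1 := hR1.norm_sub_one_mul_pow_le hR m
      have hz : ‖((τ⁻¹ : ℝ) : ℂ) + Complex.I * (s : ℂ)‖ ≤ τ⁻¹ + |s| := by
        refine (norm_add_le _ _).trans_eq ?_
        rw [norm_mul, Complex.norm_I, one_mul, Complex.norm_real, Complex.norm_real,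
          Real.norm_of_nonneg (by positivity), Real.norm_eq_abs]
      have hRm : ‖R‖ ^ m ≤ K ^ m * E := by
        calc ‖R‖ ^ m ≤ (K * τ) ^ m := by gcongr
          _ = K ^ m * τ ^ m := mul_pow _ _ _
          _ ≤ K ^ m * E := by gcongr
      have hRnpow : ‖R‖ ^ n ≤ K ^ n * τ ^ n := by
        rw [← mul_pow]
        gcongr
      have h2 : τ⁻¹ * ‖R‖ ^ n ≤ K ^ n * E := by
        calc τ⁻¹ * ‖R‖ ^ n ≤ τ⁻¹ * (K ^ n * τ ^ n) := by gcongr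
          _ = K ^ n * τ ^ m := by
            simp only [n, pow_succ]
            field_simp
          _ ≤ K ^ n * E := by gcongr
      have h3 : |s| * ‖R‖ ^ n ≤ (L ^ n * Q + K ^ n) * E := by
        rw [add_mul]
        have hp1 : 0 ≤ L ^ n * Q * E := by positivity
        have hp2 : 0 ≤ K ^ n * E := by positivity
        rcases le_total |s| σ⁻¹ with hsσ | hsσ
        · have : |s| * ‖R‖ ^ n ≤ K ^ n * E := by
            calc |s| * ‖R‖ ^ n ≤ σ⁻¹ * (K ^ n * τ ^ n) := by gcongr
              _ = K ^ n * E := by simp only [E]; ring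
          linarith
        · have hs0 : 0 < |s| := abs_pos.2 hs
          have hP : ‖Rop s‖ ≤ M |s|⁻¹ :=
            hres _ ((one_le_inv₀ hs0).2 hs1) s (inv_inv |s|).le hs1
          have : |s| * ‖R‖ ^ n ≤ L ^ n * Q * E := by
            calc |s| * ‖R‖ ^ n ≤ |s| * (L * M |s|⁻¹) ^ n := by
                  gcongr
                  exact hRP.trans (by gcongr)
              _ = L ^ n * (|s| * M |s|⁻¹ ^ n) := by rw [mul_pow]; ring
              _ ≤ L ^ n * (Q * E) :=
                  mul_le_mul_of_nonneg_left (hQ τ σ |s| hσ hστ hMσ hsσ hs1) (by positivity)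
              _ = L ^ n * Q * E := by ring
          linarith
      have h4 : ‖((τ⁻¹ : ℝ) : ℂ) + Complex.I * (s : ℂ)‖ * ‖R‖ ^ n ≤
          (L ^ n * Q + 2 * K ^ n) * E := by
        have := mul_le_mul_of_nonneg_right hz (by positivity : 0 ≤ ‖R‖ ^ n)
        linarith
      calc ‖(R1 - 1) * R ^ n‖
          ≤ ‖R1‖ * ((L ^ n * Q + 2 * K ^ n) * E + K ^ m * E) := h1.trans (by gcongr)
        _ = C₁ * E := by simp only [C₁]; ring
        _ ≤ (C₁ + C₂) * E := by gcongr; linarith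
    · have h1 : ‖R1 - 1‖ ≤ ‖R1‖ + 1 := (norm_sub_le _ _).trans (by
        gcongr
        exact ContinuousLinearMap.norm_id_le)
      calc ‖(R1 - 1) * R ^ n‖ ≤ ‖R1 - 1‖ * ‖R‖ ^ n := norm_mul_pow_le _ _ _
        _ ≤ C₂ := by
          simp only [C₂]
          gcongr
          exact hRP.trans (by gcongr; exact hB s hs1)
        _ ≤ C₂ * E := le_mul_of_one_le_right hC₂ hE1
        _ ≤ (C₁ + C₂) * E := by gcongr; linarith
  calc ‖T τ ∘L (R1 - 1)‖ ≤ C₃ * ((C₁ + C₂) * E / τ ^ n) :=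
        hA.norm_comp_le_of_resolvent_pow_le hT hK0 hK hR1 hcomm hτ0 (by positivity) hbound
    _ = C₃ * (C₁ + C₂) / σ := by
        simp only [E]
        field_simp
    _ ≤ (C₃ * (C₁ + C₂) + 1) / σ := by
        gcongr
        linarith

end
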